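/- Assume t is even, t is congruent to neither 0 nor 1 modulo p, and g_t(x,y) is irreducible in F_p[x,y]. Let E := {d ∈ N : d > 2 and d divides either t or t − 1}, and for each d ∈ E let e_d be the multiplicative order of p modulo d. If gcd{e_d : d ∈ E} = 1, then the image of g_t in F̄_p[x,y] is irreducible, i.e. g_t is absolutely irreducible. -/

import Mathlib

open MvPolynomial

noncomputable section

section Frobenius

variable {p : ℕ} [Fact p.Prime] {K : Type*} [Field K] [ExpChar K p] [Algebra (ZMod p) K]
  {σ : Type*}

theorem exists_map_eq_of_map_frobenius_eq {P : MvPolynomial σ K}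
    (hP : map (frobenius K p) P = P) : ∃ Q, map (algebraMap (ZMod p) K) Q = P := by
  have : CharP K p := charP_of_injective_algebraMap (algebraMap (ZMod p) K).injective p
  change P ∈ Set.range _
  rw [mem_range_map_iff_coeffs_subset]
  intro a ha
  obtain ⟨m, -, rfl⟩ := mem_coeffs_iff.mp ha
  have h : coeff m P ^ p = coeff m P := by
    conv_rhs => rw [← hP]
    rw [coeff_map, frobenius_def]
  rw [← Subfield.mem_bot_iff_pow_eq_self] at h
  exact (bot_le : ⊥ ≤ (algebraMap (ZMod p) K).fieldRange) h

theorem associated_of_dvd_map_of_map_frobenius_eq {g : MvPolynomial σ (ZMod p)}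
    (hg : Irreducible g) {P : MvPolynomial σ K} (hdvd : P ∣ map (algebraMap (ZMod p) K) g)
    (hP : map (frobenius K p) P = P) (hu : ¬ IsUnit P) :
    Associated (map (algebraMap (ZMod p) K) g) P := by
  have hinj : Function.Injective (map (σ := σ) (algebraMap (ZMod p) K)) :=
    map_injective _ (algebraMap (ZMod p) K).injective
  obtain ⟨Q, hQ⟩ := hdvd
  have hG : map (algebraMap (ZMod p) K) g ≠ 0 := by
    rw [Ne, map_eq_zero_iff _ hinj]
    exact hg.ne_zero
  have hP0 : P ≠ 0 := by
    rintro rfl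
    exact hG (by rw [hQ, zero_mul])
  have hfix : map (frobenius K p) Q = Q := by
    refine mul_left_cancel₀ hP0 ?_
    rw [← hQ]
    conv_lhs => rw [← hP]
    rw [← map_mul, ← hQ, MvPolynomial.map_map]
    congr 2
    exact RingHom.ext fun x ↦ by
      rw [RingHom.comp_apply, frobenius_def, ← map_pow, ZMod.pow_card]
  obtain ⟨P', rfl⟩ := exists_map_eq_of_map_frobenius_eq hP
  obtain ⟨Q', rfl⟩ := exists_map_eq_of_map_frobenius_eq hfix
  rw [← map_mul] at hQ
  rcases hg.isUnit_or_isUnit (hinj hQ) with h | h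
  · exact absurd (h.map _) hu
  · rw [hQ, map_mul]
    exact associated_mul_unit_left _ _ (h.map _)

theorem mem_periodicPts_frobenius [Algebra.IsAlgebraic (ZMod p) K] (a : K) :
    a ∈ Function.periodicPts (frobenius K p) := by
  have : CharP K p := charP_of_injective_algebraMap (algebraMap (ZMod p) K).injective p
  let L := IntermediateField.adjoin (ZMod p) {a}
  have : FiniteDimensional (ZMod p) L :=
    IntermediateField.adjoin.finiteDimensional (Algebra.IsIntegral.isIntegral a)
  have : Finite L := Module.finite_of_finite (ZMod p)
  have := Fintype.ofFinite L
  obtain ⟨n, -, hn⟩ := FiniteField.card L p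
  refine ⟨n, n.2, ?_⟩
  have h := FiniteField.pow_card (⟨a, IntermediateField.mem_adjoin_simple_self _ a⟩ : L)
  rw [hn] at h
  rw [Function.IsPeriodicPt, Function.IsFixedPt, iterate_frobenius]
  exact congrArg Subtype.val h

theorem coeff_iterate_map (φ : K →+* K) (n : ℕ) (P : MvPolynomial σ K) (m : σ →₀ ℕ) :
    coeff m ((map φ)^[n] P) = φ^[n] (coeff m P) := by
  induction n with
  | zero => rfl
  | succ n ih => rw [Function.iterate_succ_apply', Function.iterate_succ_apply', coeff_map, ih]

theorem mem_periodicPts_map {φ : K →+* K} (hφ : ∀ a, a ∈ Function.periodicPts φ)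
    (P : MvPolynomial σ K) : P ∈ Function.periodicPts (map φ) := by
  refine ⟨∏ m ∈ P.support, Function.minimalPeriod φ (coeff m P),
    Finset.prod_pos fun m _ ↦ Function.minimalPeriod_pos_of_mem_periodicPts (hφ _), ?_⟩
  refine MvPolynomial.ext _ _ fun m ↦ ?_
  rw [coeff_iterate_map]
  by_cases hm : m ∈ P.support
  · exact (Function.isPeriodicPt_minimalPeriod φ _).trans_dvd (Finset.dvd_prod_of_mem _ hm)
  · rw [notMem_support_iff.mp hm, iterate_map_zero]

theorem eq_of_associated_of_coeff_eq_one {P Q : MvPolynomial σ K} {m : σ →₀ ℕ}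
    (hP : coeff m P = 1) (hQ : coeff m Q = 1) (h : Associated P Q) : P = Q := by
  obtain ⟨u, rfl⟩ := h
  obtain ⟨c, -, hc⟩ := MvPolynomial.isUnit_iff_eq_C_of_isReduced.mp u.isUnit
  rw [hc, mul_comm, coeff_C_mul, hP, mul_one] at hQ
  rw [hc, hQ, C_1, mul_one]

theorem Finset.prod_dvd_of_prime_of_eq_of_associated {M : Type*} [CommMonoidWithZero M]
    [IsCancelMulZero M] {s : Finset M} {n : M} (hs : ∀ a ∈ s, Prime a) (hn : ∀ a ∈ s, a ∣ n) (heq : ∀ a ∈ s, ∀ b ∈ s, Associated a b → a = b) :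
    ∏ a ∈ s, a ∣ n := by
  classical
  induction s using Finset.induction_on with
  | empty => simp
  | insert a s ha ih =>
    obtain ⟨q, rfl⟩ := ih (fun b hb ↦ hs b (by simp [hb])) (fun b hb ↦ hn b (by simp [hb]))
      (fun b hb c hc ↦ heq b (by simp [hb]) c (by simp [hc]))
    have hpa := hs a (by simp)
    rw [Finset.prod_insert ha, mul_comm]
    refine mul_dvd_mul_left _ ((hpa.dvd_or_dvd (hn a (by simp))).resolve_left fun h ↦ ?_)
    obtain ⟨b, hb, hab⟩ := hpa.exists_mem_finset_dvd h
    have := heq a (by simp) b (by simp [hb])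
      ((hpa.dvd_prime_iff_associated (hs b (by simp [hb]))).mp hab)
    exact ha (this ▸ hb)

/-- If every `e i` is the degree of a field of definition of a simple root of the image of `g`
under a multiplicative map compatible with the Frobenius, and the `e i` are jointly coprime, then
the irreducible polynomial `g` is absolutely irreducible. -/
theorem irreducible_map_of_simple_roots [Algebra.IsAlgebraic (ZMod p) K]
    {g : MvPolynomial σ (ZMod p)} (hg : Irreducible g) {ι : Type*} (s : Finset ι) (e : ι → ℕ)
    (he : s.gcd e = 1)
    (hroot : ∀ i ∈ s, ∃ (L : MvPolynomial σ K →* Polynomial K) (a : K),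
      (∀ P, L (map (frobenius K p) P) = (L P).map (frobenius K p)) ∧ a ^ p ^ e i = a ∧
      (L (map (algebraMap (ZMod p) K) g)).IsRoot a ∧
      ¬ (Polynomial.X - Polynomial.C a) ^ 2 ∣ L (map (algebraMap (ZMod p) K) g)) :
    Irreducible (map (algebraMap (ZMod p) K) g) := by
  classical
  set G := map (algebraMap (ZMod p) K) g with hGdef
  set Φ := map (σ := σ) (frobenius K p) with hΦdef
  have hinj : Function.Injective (map (σ := σ) (algebraMap (ZMod p) K)) :=
    map_injective _ (algebraMap (ZMod p) K).injective
  have hΦinj : Function.Injective Φ := map_injective _ (frobenius K p).injective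
  have hG0 : G ≠ 0 := by
    rw [Ne, hGdef, map_eq_zero_iff _ hinj]
    exact hg.ne_zero
  have hGu : ¬ IsUnit G := fun h ↦ hg.not_isUnit (by
    rw [MvPolynomial.isUnit_iff] at h ⊢
    simpa [hGdef, coeff_map, isUnit_iff_ne_zero] using h)
  have hGfix : Φ G = G := by
    rw [hΦdef, hGdef, MvPolynomial.map_map]
    congr 2
    exact RingHom.ext fun x ↦ by
      rw [RingHom.comp_apply, frobenius_def, ← map_pow, ZMod.pow_card]
  obtain ⟨H₀, hH₀, hH₀G⟩ := WfDvdMonoid.exists_irreducible_factor hGu hG0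
  obtain ⟨m, hm⟩ := ne_zero_iff.mp hH₀.ne_zero
  obtain ⟨H, hHm, hHH₀⟩ : ∃ H, coeff m H = 1 ∧ Associated H₀ H := by
    refine ⟨C (coeff m H₀)⁻¹ * H₀, by rw [coeff_C_mul, inv_mul_cancel₀ hm], ?_⟩
    exact (associated_unit_mul_right _ _ ((isUnit_iff_ne_zero.mpr (inv_ne_zero hm)).map C))
  set T : ℕ → MvPolynomial σ K := fun n ↦ Φ^[n] H with hT
  have hTs : ∀ n, T (n + 1) = Φ (T n) := fun n ↦ Function.iterate_succ_apply' _ _ _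
  have hTm : ∀ n, coeff m (T n) = 1 := fun n ↦ by
    rw [hT, hΦdef]
    simp only
    rw [coeff_iterate_map, hHm, iterate_map_one]
  have hTdvd : ∀ n, T n ∣ G := by
    intro n
    induction n with
    | zero => exact hHH₀.symm.dvd.trans hH₀G
    | succ n ih =>
      rw [hTs, ← hGfix]
      exact map_dvd Φ ih
  have hbij : Function.Bijective Φ := by
    refine ⟨hΦinj, map_surjective _ fun a ↦ ?_⟩
    obtain ⟨n, hn, h⟩ := mem_periodicPts_frobenius (p := p) a
    obtain ⟨k, rfl⟩ := Nat.exists_eq_succ_of_ne_zero hn.ne'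
    exact ⟨(frobenius K p)^[k] a, (Function.iterate_succ_apply' _ _ _).symm.trans h⟩
  have hTprime : ∀ n, Prime (T n) := by
    intro n
    induction n with
    | zero => exact (hHH₀.irreducible hH₀).prime
    | succ n ih =>
      rw [hTs]
      exact (MulEquiv.prime_iff (RingEquiv.ofBijective Φ hbij)).mpr ih
  have hTeq : ∀ {i j}, Associated (T i) (T j) → T i = T j :=
    fun h ↦ eq_of_associated_of_coeff_eq_one (hTm _) (hTm _) h
  have hper : 0 < Function.minimalPeriod Φ H :=
    Function.minimalPeriod_pos_of_mem_periodicPts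
      (mem_periodicPts_map (fun a ↦ mem_periodicPts_frobenius (p := p) a) H)
  set N := Function.minimalPeriod Φ H with hN
  set S := (Finset.range N).image T with hS
  have hSmem : ∀ n, T n ∈ S := fun n ↦ Finset.mem_image.mpr
    ⟨n % N, Finset.mem_range.mpr (Nat.mod_lt _ hper), Function.iterate_mod_minimalPeriod_eq⟩
  have hSex : ∀ P ∈ S, ∃ n, T n = P := fun P hP ↦ by
    obtain ⟨n, -, h⟩ := Finset.mem_image.mp hP
    exact ⟨n, h⟩
  have hSdvd : ∏ P ∈ S, P ∣ G := by
    refine Finset.prod_dvd_of_prime_of_eq_of_associated ?_ ?_ ?_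
    · intro P hP
      obtain ⟨n, rfl⟩ := hSex P hP
      exact hTprime n
    · intro P hP
      obtain ⟨n, rfl⟩ := hSex P hP
      exact hTdvd n
    · intro P hP Q hQ h
      obtain ⟨n, rfl⟩ := hSex P hP
      obtain ⟨k, rfl⟩ := hSex Q hQ
      exact hTeq h
  have hSfix : Φ (∏ P ∈ S, P) = ∏ P ∈ S, P := by
    have himage : S.image Φ = S := by
      refine Finset.eq_of_subset_of_card_le ?_ (Finset.card_image_of_injective _ hΦinj).ge
      intro P hP
      obtain ⟨Q, hQ, rfl⟩ := Finset.mem_image.mp hP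
      obtain ⟨n, rfl⟩ := hSex Q hQ
      rw [← hTs]
      exact hSmem _
    conv_rhs => rw [← himage, Finset.prod_image hΦinj.injOn]
    exact map_prod _ _ _
  have hSu : ¬ IsUnit (∏ P ∈ S, P) := fun h ↦
    (hTprime 0).not_isUnit (isUnit_of_dvd_unit (Finset.dvd_prod_of_mem (fun P ↦ P) (hSmem 0)) h)
  have hGS := associated_of_dvd_map_of_map_frobenius_eq hg hSdvd hSfix hSu
  have hdvd : ∀ i ∈ s, N ∣ e i := by
    intro i hi
    obtain ⟨L, a, hL, ha, hLa, hLs⟩ := hroot i hi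
    have hp : Prime (Polynomial.X - Polynomial.C a) := Polynomial.prime_X_sub_C a
    obtain ⟨P, hP, hPa⟩ : ∃ P ∈ S, Polynomial.X - Polynomial.C a ∣ L P := by
      refine hp.exists_mem_finset_dvd ?_
      rw [← map_prod]
      exact (Polynomial.dvd_iff_isRoot.mpr hLa).trans (map_dvd L hGS.dvd)
    obtain ⟨n, rfl⟩ := hSex P hP
    have hroots : ∀ k, (L (T (n + k))).IsRoot ((frobenius K p)^[k] a) := by
      intro k
      induction k with
      | zero => exact Polynomial.dvd_iff_isRoot.mp hPa
      | succ k ih =>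
        rw [← add_assoc, hTs, hL, Function.iterate_succ_apply']
        exact ih.map
    have hroot' := hroots (e i)
    rw [iterate_frobenius, ha, ← Polynomial.dvd_iff_isRoot] at hroot'
    have heq : T n = T (n + e i) := by
      obtain ⟨Q, hQ⟩ := hTdvd n
      have hd := hTdvd (n + e i)
      rw [hQ] at hd
      rcases (hTprime _).dvd_or_dvd hd with h | h
      · exact (hTeq (((hTprime _).dvd_prime_iff_associated (hTprime _)).mp h)).symm
      · refine absurd ?_ hLs
        rw [hQ, map_mul, sq]
        exact mul_dvd_mul hPa (hroot'.trans (map_dvd L h))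
    refine Function.IsPeriodicPt.minimalPeriod_dvd ?_
    refine hΦinj.iterate n ?_
    rw [← Function.iterate_add_apply]
    exact heq.symm
  have hN1 : N = 1 := Nat.dvd_one.mp (he ▸ Finset.dvd_gcd hdvd)
  have hHfix : Φ H = H := Function.minimalPeriod_eq_one_iff_isFixedPt.mp hN1
  exact (associated_of_dvd_map_of_map_frobenius_eq hg (hTdvd 0) hHfix
    (hTprime 0).not_isUnit).symm.irreducible (hTprime 0).irreducible

end Frobenius

theorem aeval_map_eq_of_map_eq {R A σ : Type*} [CommSemiring R] [CommSemiring A] [Algebra R A]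
    {φ : R →+* R} {ψ : A →+* A} (h : ∀ r, ψ (algebraMap R A r) = algebraMap R A (φ r))
    {x : σ → A} (hx : ∀ i, ψ (x i) = x i) (P : MvPolynomial σ R) :
    aeval x (map φ P) = ψ (aeval x P) := by
  induction P using MvPolynomial.induction_on with
  | C r => simp [h]
  | add P Q hP hQ => simp [hP, hQ]
  | mul_X P i hP => simp [hP, hx]

theorem coeff_C_mul_X_add_one_pow {A : Type*} [CommRing A] (u : A) (t k : ℕ) :
    ((Polynomial.C u * Polynomial.X + 1 : Polynomial A) ^ t).coeff k = t.choose k * u ^ k := by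
  rw [← Polynomial.coeff_X_add_one_pow A t k, ← Polynomial.comp_C_mul_X_coeff]
  simp

theorem leadingCoeff_sub_pow {A : Type*} [CommRing A] (u : A) {t : ℕ} (ht : 0 < t)
    (hu : (t : A) * (u ^ (t - 1) - 1) ≠ 0) :
    ((Polynomial.C u * Polynomial.X + 1) ^ t - (Polynomial.C u * Polynomial.X) ^ t
      - (Polynomial.X + 1) ^ t + Polynomial.X ^ t : Polynomial A).leadingCoeff
      = (t : A) * (u ^ (t - 1) - 1) := by
  obtain ⟨n, rfl⟩ := Nat.exists_eq_succ_of_ne_zero ht.ne'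
  set P := ((Polynomial.C u * Polynomial.X + 1) ^ n.succ - (Polynomial.C u * Polynomial.X) ^ n.succ
      - (Polynomial.X + 1) ^ n.succ + Polynomial.X ^ n.succ : Polynomial A) with hP
  have hcoeff : ∀ k, P.coeff k = (n.succ.choose k * u ^ k) - (if k = n.succ then u ^ n.succ else 0)
      - n.succ.choose k + (if k = n.succ then 1 else 0) := by
    intro k
    rw [hP, mul_pow, ← Polynomial.C_pow]
    simp only [Polynomial.coeff_add, Polynomial.coeff_sub, coeff_C_mul_X_add_one_pow,
      Polynomial.coeff_C_mul_X_pow, Polynomial.coeff_X_add_one_pow, Polynomial.coeff_X_pow]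
  have hn : P.coeff n = (n.succ : A) * (u ^ n - 1) := by
    rw [hcoeff, if_neg (by simp), if_neg (by simp), Nat.choose_succ_self_right]
    push_cast
    ring
  have hdeg : P.natDegree = n := by
    refine Polynomial.natDegree_eq_of_le_of_coeff_ne_zero
      (Polynomial.natDegree_le_iff_coeff_eq_zero.mpr fun k hk ↦ ?_) (hn ▸ hu)
    rw [hcoeff]
    rcases eq_or_lt_of_le (Nat.succ_le_of_lt hk) with rfl | h
    · simp
    · rw [if_neg h.ne', if_neg h.ne', Nat.choose_eq_zero_of_lt h]
      simp
  rw [Polynomial.leadingCoeff, hdeg, hn, Nat.succ_sub_one]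

theorem isRoot_and_not_sq_dvd_of_mul_eq {K : Type*} [Field K] {A B F : Polynomial K}
    (h : F = A * B) {a : K} (hF : F.IsRoot a) (hA : ¬ A.IsRoot a)
    (hF' : ¬ (Polynomial.derivative F).IsRoot a) :
    B.IsRoot a ∧ ¬ (Polynomial.X - Polynomial.C a) ^ 2 ∣ B := by
  refine ⟨?_, fun ⟨Q, hQ⟩ ↦ hF' ?_⟩
  · rw [h, Polynomial.IsRoot, Polynomial.eval_mul] at hF
    exact (mul_eq_zero.mp hF).resolve_left hA
  · rw [h, hQ]
    simp [Polynomial.derivative_pow]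

/-- The multiplicative map takes a polynomial to its form of highest degree, dehomogenized. -/
theorem exists_simple_root_of_pow_sub_one_eq_one {p t n : ℕ} {K : Type*} [Field K] [ExpChar K p]
    (ht : 2 ≤ t) (ht0 : (t : K) ≠ 0) (ht1 : ((t - 1 : ℕ) : K) ≠ 0) {ζ : K}
    (hζ : ζ ^ (t - 1) = 1) (hζ1 : ζ ≠ 1) (hfix : ζ ^ p ^ n = ζ) {G : MvPolynomial (Fin 2) K}
    (hG : (X 0 + 1) ^ t - X 0 ^ t - (X 1 + 1) ^ t + X 1 ^ t = (X 0 - X 1) * G) :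
    ∃ (L : MvPolynomial (Fin 2) K →* Polynomial K) (a : K),
      (∀ P, L (map (frobenius K p) P) = (L P).map (frobenius K p)) ∧ a ^ p ^ n = a ∧
      (L G).IsRoot a ∧ ¬ (Polynomial.X - Polynomial.C a) ^ 2 ∣ L G := by
  let θ : MvPolynomial (Fin 2) K →ₐ[K] Polynomial (Polynomial K) :=
    aeval ![Polynomial.C Polynomial.X * Polynomial.X, Polynomial.X]
  have h0 : θ (X 0) = Polynomial.C Polynomial.X * Polynomial.X := by simp [θ]
  have h1 : θ (X 1) = Polynomial.X := by simp [θ]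
  have hζ0 : ζ ≠ 0 := by
    rintro rfl
    rw [zero_pow (by omega)] at hζ
    exact zero_ne_one hζ
  have hne : (t : Polynomial K) * (Polynomial.X ^ (t - 1) - 1) ≠ 0 := by
    refine mul_ne_zero ?_ (Polynomial.X_pow_sub_C_ne_zero (by omega) 1)
    exact_mod_cast Polynomial.C_ne_zero.mpr ht0
  refine ⟨Polynomial.leadingCoeffHom.comp θ.toRingHom.toMonoidHom, ζ, fun P ↦ ?_, hfix, ?_⟩
  · change (θ _).leadingCoeff = (θ _).leadingCoeff.map _
    rw [aeval_map_eq_of_map_eq (ψ := Polynomial.mapRingHom (Polynomial.mapRingHom (frobenius K p)))]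
    · exact Polynomial.leadingCoeff_map_of_injective
        (Polynomial.map_injective _ (frobenius K p).injective) _
    · intro r
      simp [Polynomial.algebraMap_apply]
    · intro i
      fin_cases i <;> simp
  · have h := congrArg (fun P ↦ (θ P).leadingCoeff) hG
    simp only [map_mul, map_add, map_sub, map_pow, map_one, h0, h1, Polynomial.leadingCoeff_mul] at h
    rw [leadingCoeff_sub_pow _ (by omega) hne] at h
    have h2 : (Polynomial.C (Polynomial.X : Polynomial K) * Polynomial.X - Polynomial.X).leadingCoeff
        = Polynomial.X - 1 := by
      rw [← sub_one_mul, ← Polynomial.C_1, ← Polynomial.C_sub, Polynomial.leadingCoeff_C_mul_X]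
    rw [h2] at h
    refine isRoot_and_not_sq_dvd_of_mul_eq h ?_ ?_ ?_
    · simp [hζ]
    · simpa [sub_eq_zero] using hζ1
    · simp [ht0, ht1, hζ0, Polynomial.derivative_X_pow]

/-- The multiplicative map is the restriction to the line `y = -1/2`. -/
theorem exists_simple_root_of_pow_eq_one {p t n : ℕ} {K : Type*} [Field K] [ExpChar K p]
    (ht : 2 ≤ t) (hte : Even t) (h2 : (2 : K) ≠ 0) (ht0 : (t : K) ≠ 0) {ζ : K}
    (hζ : ζ ^ t = 1) (hζ1 : ζ ≠ 1) (hζ2 : ζ ≠ -1) (hfix : ζ ^ p ^ n = ζ)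
    {G : MvPolynomial (Fin 2) K}
    (hG : (X 0 + 1) ^ t - X 0 ^ t - (X 1 + 1) ^ t + X 1 ^ t = (X 0 - X 1) * G) :
    ∃ (L : MvPolynomial (Fin 2) K →* Polynomial K) (a : K),
      (∀ P, L (map (frobenius K p) P) = (L P).map (frobenius K p)) ∧ a ^ p ^ n = a ∧
      (L G).IsRoot a ∧ ¬ (Polynomial.X - Polynomial.C a) ^ 2 ∣ L G := by
  let θ : MvPolynomial (Fin 2) K →ₐ[K] Polynomial K :=
    aeval ![Polynomial.X, Polynomial.C (-2⁻¹)]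
  have h0 : θ (X 0) = Polynomial.X := by simp [θ]
  have h1 : θ (X 1) = Polynomial.C (-2⁻¹) := by simp [θ]
  have hζ0 : ζ ≠ 0 := by
    rintro rfl
    rw [zero_pow (by omega)] at hζ
    exact zero_ne_one hζ
  have hsub : ζ - 1 ≠ 0 := sub_ne_zero.mpr hζ1
  have hy : (Polynomial.C (-2⁻¹ : K) + 1) ^ t = Polynomial.C (-2⁻¹ : K) ^ t := by
    rw [← Polynomial.C_1, ← Polynomial.C_add, Polynomial.C_neg, hte.neg_pow]
    congr 2
    field_simp
    norm_num
  have hadd : (ζ - 1)⁻¹ + 1 = ζ * (ζ - 1)⁻¹ := by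
    field_simp
    ring
  refine ⟨θ.toRingHom.toMonoidHom, (ζ - 1)⁻¹, fun P ↦ ?_, ?_, ?_⟩
  · change θ _ = (θ _).map _
    refine aeval_map_eq_of_map_eq (ψ := Polynomial.mapRingHom (frobenius K p)) (fun r ↦ ?_)
      (fun i ↦ ?_) P
    · simp
    · fin_cases i <;> simp [map_ofNat (frobenius K p) 2]
  · rw [inv_pow, sub_pow_expChar_pow, one_pow, hfix]
  · have h := congrArg θ hG
    simp only [map_mul, map_add, map_sub, map_pow, map_one, h0, h1] at h
    rw [hy, sub_add_cancel] at h
    refine isRoot_and_not_sq_dvd_of_mul_eq h ?_ ?_ ?_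
    · simp [hadd, mul_pow, hζ]
    · intro hr
      simp only [Polynomial.IsRoot, Polynomial.eval_sub, Polynomial.eval_X, Polynomial.eval_C,
        sub_neg_eq_add] at hr
      field_simp at hr
      exact hζ2 (by linear_combination hr)
    · intro hr
      simp [Polynomial.derivative_pow, hadd, mul_pow, ← mul_sub, ht0] at hr
      rw [← sub_one_mul] at hr
      have hpow : ζ ^ (t - 1) = 1 := sub_eq_zero.mp
        ((mul_eq_zero.mp hr).resolve_right (inv_ne_zero (pow_ne_zero _ hsub)))
      refine hζ1 ?_
      rw [← hζ, ← pow_sub_one_mul (by omega : t ≠ 0), hpow, one_mul]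

theorem IsPrimitiveRoot.pow_pow_orderOf_natCast {M : Type*} [CommMonoid M] {ζ : M} {d : ℕ}
    (hζ : IsPrimitiveRoot ζ d) (q : ℕ) : ζ ^ q ^ orderOf (q : ZMod d) = ζ := by
  have h : q ^ orderOf (q : ZMod d) ≡ 1 [MOD d] := by
    rw [← ZMod.natCast_eq_natCast_iff, Nat.cast_pow, Nat.cast_one, pow_orderOf_eq_one]
  have h' : q ^ orderOf (q : ZMod d) % orderOf ζ = 1 % orderOf ζ := by
    rw [← hζ.eq_orderOf]
    exact h
  rw [← pow_mod_orderOf, h', pow_mod_orderOf, pow_one]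

/-- Case (A), condition (g): if `g_t` is irreducible over `F_p` and the gcd of
the multiplicative orders `e_d` of `p` modulo `d`, taken over all `d > 2`
dividing `t` or `t-1`, equals `1`, then `g_t` is absolutely irreducible. -/
theorem gt_abs_irred_of_irred_and_orders
    (p t : ℕ) [Fact p.Prime] (hp2 : p ≠ 2) (ht : 3 ≤ t) (hpt : ¬ p ∣ t)
    (g : MvPolynomial (Fin 2) (ZMod p))
    (hg : ((X 0 + 1) ^ t - X 0 ^ t - (X 1 + 1) ^ t + X 1 ^ t : MvPolynomial (Fin 2) (ZMod p))
        = (X 0 - X 1) * g)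
    (hte : Even t) (h0 : t % p ≠ 0) (h1 : t % p ≠ 1)
    (hirr : Irreducible g)
    (hgcd : ((Finset.range (t + 1)).filter
        (fun d => 2 < d ∧ (d ∣ t ∨ d ∣ (t - 1)))).gcd
          (fun d => orderOf ((p : ZMod d))) = 1) :
    Irreducible (MvPolynomial.map (algebraMap (ZMod p) (AlgebraicClosure (ZMod p))) g) := by
  have hp : p.Prime := Fact.out
  set K := AlgebraicClosure (ZMod p)
  refine irreducible_map_of_simple_roots hirr _ _ hgcd fun d hd ↦ ?_
  obtain ⟨-, hd2, hdt⟩ := Finset.mem_filter.mp hd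
  have hpt1 : ¬ p ∣ t - 1 := fun h ↦ h1 (by
    have := (Nat.modEq_iff_dvd' (by omega)).mpr h
    rw [← this, Nat.mod_eq_of_lt hp.one_lt])
  have hpd : ¬ p ∣ d := fun h ↦ hdt.elim (fun h' ↦ hpt (h.trans h')) fun h' ↦ hpt1 (h.trans h')
  have hcast : ∀ {n : ℕ}, ¬ p ∣ n → (n : K) ≠ 0 := fun h ↦ by
    rwa [Ne, CharP.cast_eq_zero_iff K p]
  have : NeZero (d : K) := ⟨hcast hpd⟩
  obtain ⟨ζ, hζ⟩ := HasEnoughRootsOfUnity.exists_primitiveRoot K d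
  have hζ1 : ζ ≠ 1 := hζ.ne_one (by omega)
  have hζ2 : ζ ≠ -1 := fun h ↦ by
    have := Nat.le_of_dvd two_pos (hζ.dvd_of_pow_eq_one 2 (by rw [h]; norm_num))
    omega
  have hfix := hζ.pow_pow_orderOf_natCast p
  have hG := congrArg (map (algebraMap (ZMod p) K)) hg
  simp only [map_mul, map_add, map_sub, map_pow, map_one, map_X] at hG
  rcases hdt with h | h
  · have h2 : (2 : K) ≠ 0 := by
      exact_mod_cast hcast (n := 2) fun h ↦ hp2 ((Nat.prime_dvd_prime_iff_eq hp Nat.prime_two).mp h)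
    exact exists_simple_root_of_pow_eq_one (by omega) hte h2 (hcast hpt)
      ((hζ.pow_eq_one_iff_dvd t).mpr h) hζ1 hζ2 hfix hG
  · exact exists_simple_root_of_pow_sub_one_eq_one (by omega) (hcast hpt) (hcast hpt1)
      ((hζ.pow_eq_one_iff_dvd _).mpr h) hζ1 hfix hG
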